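/- Let d ≥ 1 and let T be any subset of {0, 1, …, d}. Then there exist convex sets K₁, K₂ ⊆ ℝ^d such that, setting S = ℝ^d \ (K₁ ∪ K₂), for every 0 ≤ k ≤ d the set S has a k-ordinary flat if and only if k ∈ T. -/

import Mathlib

open Metric Set Module

/-- `HasSimplex S k` : the set `S` contains a `k`-simplex, i.e. the convex hull
of `k+1` affinely independent points. -/
def HasSimplex {d : ℕ} (S : Set (EuclideanSpace ℝ (Fin d))) (k : ℕ) : Prop :=
  ∃ f : Fin (k + 1) → EuclideanSpace ℝ (Fin d),
    AffineIndependent ℝ f ∧ convexHull ℝ (Set.range f) ⊆ S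

/-- The flat-dimension `dm S` of a set `S ⊆ ℝ^d`: the maximal `k` such that `S`
contains a `k`-simplex. -/
noncomputable def dm {d : ℕ} (S : Set (EuclideanSpace ℝ (Fin d))) : ℕ :=
  sSup {k : ℕ | HasSimplex S k}

/-- The local dimension `dmLoc S p` of `S` at `p`: the minimum over `ε > 0` of
the flat-dimension of `S ∩ B(p, ε)`. -/
noncomputable def dmLoc {d : ℕ} (S : Set (EuclideanSpace ℝ (Fin d)))
    (p : EuclideanSpace ℝ (Fin d)) : ℕ :=
  sInf {m : ℕ | ∃ ε > 0, m = dm (S ∩ ball p ε)}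

/-- `p` is a `k`-ordinary point of `S`: its local dimension is `k` and, near `p`,
`S` coincides with a `k`-flat. -/
def IsOrdinaryPoint {d : ℕ} (S : Set (EuclideanSpace ℝ (Fin d))) (k : ℕ)
    (p : EuclideanSpace ℝ (Fin d)) : Prop :=
  p ∈ S ∧ dmLoc S p = k ∧
    ∃ H : AffineSubspace ℝ (EuclideanSpace ℝ (Fin d)),
      finrank ℝ H.direction = k ∧
      ∃ U, IsOpen U ∧ p ∈ U ∧ S ∩ U = (H : Set (EuclideanSpace ℝ (Fin d))) ∩ U

/-- `H` is a `k`-ordinary flat of `S`: `H` is a `k`-flat which witnesses some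
`k`-ordinary point of `S`. -/
def IsOrdinaryFlat {d : ℕ} (S : Set (EuclideanSpace ℝ (Fin d))) (k : ℕ)
    (H : AffineSubspace ℝ (EuclideanSpace ℝ (Fin d))) : Prop :=
  finrank ℝ H.direction = k ∧
    ∃ p ∈ S, dmLoc S p = k ∧
      ∃ U, IsOpen U ∧ p ∈ U ∧ S ∩ U = (H : Set (EuclideanSpace ℝ (Fin d))) ∩ U

/-- The vectors of `ℝ^d` all of whose coordinates vanish from index `n` on. -/
def initialFlat (d n : ℕ) : Submodule ℝ (EuclideanSpace ℝ (Fin d)) where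
  carrier := {v | ∀ j : Fin d, n ≤ j → v j = 0}
  add_mem' := by
    intro a b ha hb j hj
    simp [ha j hj, hb j hj]
  zero_mem' := by
    intro j _
    simp
  smul_mem' := by
    intro c a ha j hj
    simp [ha j hj]

theorem finrank_initialFlat {d n : ℕ} (hn : n ≤ d) :
    finrank ℝ (initialFlat d n) = n := by
  let e : initialFlat d n ≃ₗ[ℝ] (Fin n → ℝ) :=
    { toFun := fun v i => v.1 (Fin.castLE hn i)
      map_add' := fun _ _ => rfl
      map_smul' := fun _ _ => rfl
      invFun := fun w =>
        ⟨WithLp.toLp 2 fun j => if h : (j : ℕ) < n then w ⟨j, h⟩ else 0, by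
          intro j hj
          simp [Nat.not_lt.mpr hj]⟩
      left_inv := by
        intro v
        ext j
        by_cases h : (j : ℕ) < n
        · simp [h]
        · simp [h, v.2 j (not_lt.mp h)]
      right_inv := by
        intro w
        ext i
        simp }
  simpa using e.finrank_eq

/-- The part of the flat `initialFlat d n` where the last free coordinate is at least
`1`; for `n = 0` it is the origin. -/
def halfFlat (d n : ℕ) : Set (EuclideanSpace ℝ (Fin d)) :=
  {x | x ∈ initialFlat d n ∧ ∀ i : Fin d, (i : ℕ) + 1 = n → 1 ≤ x i}

/-- The disjoint union of the half-flats with dimension in `T`. -/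
def stairs (d : ℕ) (T : Set ℕ) : Set (EuclideanSpace ℝ (Fin d)) :=
  {x | ∃ n ∈ T, x ∈ halfFlat d n}

/-- The vectors whose last nonzero coordinate is negative. -/
def lowerPart (d : ℕ) : Set (EuclideanSpace ℝ (Fin d)) :=
  {x | ∃ m : Fin d, x m < 0 ∧ x ∈ initialFlat d (m + 1)}

/-- The vectors outside `stairs d T` whose last nonzero coordinate, if any, is positive. -/
def upperPart (d : ℕ) (T : Set ℕ) : Set (EuclideanSpace ℝ (Fin d)) :=
  {x | (x = 0 ∧ 0 ∉ T) ∨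
    ∃ m : Fin d, 0 < x m ∧ ((m : ℕ) + 1 ∈ T → x m < 1) ∧ x ∈ initialFlat d (m + 1)}

theorem convex_lowerPart (d : ℕ) : Convex ℝ (lowerPart d) := by
  rw [convex_iff_forall_pos]
  rintro x ⟨m, hm, hx⟩ y ⟨n, hn, hy⟩ a b ha hb -
  rcases lt_trichotomy m n with h | rfl | h
  · refine ⟨n, ?_, fun j hj => ?_⟩
    · have := hx n (by omega)
      simp [this, mul_neg_of_pos_of_neg hb hn]
    · simp [hx j (by omega), hy j hj]
  · refine ⟨m, ?_, Submodule.add_mem _ (Submodule.smul_mem _ _ hx) (Submodule.smul_mem _ _ hy)⟩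
    simpa using add_neg (mul_neg_of_pos_of_neg ha hm) (mul_neg_of_pos_of_neg hb hn)
  · refine ⟨m, ?_, fun j hj => ?_⟩
    · have := hy m (by omega)
      simp [this, mul_neg_of_pos_of_neg ha hm]
    · simp [hx j hj, hy j (by omega)]

theorem convex_upperPart (d : ℕ) (T : Set ℕ) : Convex ℝ (upperPart d T) := by
  rw [convex_iff_forall_pos]
  have shrink : ∀ {a s : ℝ} {p : Prop}, 0 < a → a < 1 → 0 < s → (p → s < 1) → p → a * s < 1 := by
    intro a s p ha ha1 hs hp h
    nlinarith [hp h]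
  rintro x (⟨rfl, h0⟩ | ⟨m, hm, hmT, hx⟩) y (⟨rfl, h0'⟩ | ⟨n, hn, hnT, hy⟩) a b ha hb hab
  · exact Or.inl ⟨by simp, h0⟩
  · refine Or.inr ⟨n, ?_, ?_, ?_⟩
    · simpa using mul_pos hb hn
    · simpa using shrink hb (by linarith) hn hnT
    · simpa using Submodule.smul_mem _ b hy
  · refine Or.inr ⟨m, ?_, ?_, ?_⟩
    · simpa using mul_pos ha hm
    · simpa using shrink ha (by linarith) hm hmT
    · simpa using Submodule.smul_mem _ a hx
  rcases lt_trichotomy m n with h | rfl | h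
  · have h0 := hx n (by omega)
    refine Or.inr ⟨n, ?_, ?_, fun j hj => ?_⟩
    · simpa [h0] using mul_pos hb hn
    · simpa [h0] using shrink hb (by linarith) hn hnT
    · simp [hx j (by omega), hy j hj]
  · refine Or.inr ⟨m, ?_, fun hT => ?_,
      Submodule.add_mem _ (Submodule.smul_mem _ _ hx) (Submodule.smul_mem _ _ hy)⟩
    · simpa using add_pos (mul_pos ha hm) (mul_pos hb hn)
    · have h1 := hmT hT
      have h2 := hnT hT
      simp only [PiLp.add_apply, PiLp.smul_apply, smul_eq_mul]
      nlinarith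
  · have h0 := hy m (by omega)
    refine Or.inr ⟨m, ?_, ?_, fun j hj => ?_⟩
    · simpa [h0] using mul_pos ha hm
    · simpa [h0] using shrink ha (by linarith) hm hmT
    · simp [hx j hj, hy j (by omega)]

theorem eq_zero_or_exists_last_ne_zero {d : ℕ} (x : EuclideanSpace ℝ (Fin d)) :
    x = 0 ∨ ∃ m : Fin d, x m ≠ 0 ∧ x ∈ initialFlat d (m + 1) := by
  classical
  by_cases hx : x = 0
  · exact Or.inl hx
  right
  have hne : (Finset.univ.filter fun i => x i ≠ 0).Nonempty := by
    by_contra h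
    refine hx ?_
    ext i
    by_contra hi
    exact h ⟨i, by simpa using hi⟩
  obtain ⟨m, hm, hmax⟩ := Finset.exists_max_image _ id hne
  refine ⟨m, by simpa using hm, fun j hj => ?_⟩
  by_contra h
  have : j ≤ m := hmax j (by simpa using h)
  omega

theorem last_ne_zero_unique {d : ℕ} {x : EuclideanSpace ℝ (Fin d)} {m n : Fin d}
    (hm : x m ≠ 0) (hxm : x ∈ initialFlat d (m + 1))
    (hn : x n ≠ 0) (hxn : x ∈ initialFlat d (n + 1)) : m = n := by
  by_contra hmn
  rcases lt_or_gt_of_ne hmn with h | h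
  · exact hn (hxm n (by omega))
  · exact hm (hxn m (by omega))

theorem zero_mem_stairs {d : ℕ} {T : Set ℕ} (hT : T ⊆ Set.Iic d) :
    (0 : EuclideanSpace ℝ (Fin d)) ∈ stairs d T ↔ 0 ∈ T := by
  constructor
  · rintro ⟨n, hnT, -, hn⟩
    rcases n with _ | n
    · exact hnT
    · have := hn ⟨n, hT hnT⟩ rfl
      norm_num at this
  · exact fun h => ⟨0, h, Submodule.zero_mem _, fun i hi => by omega⟩

theorem mem_stairs_iff_of_last_ne_zero {d : ℕ} {T : Set ℕ} (hT : T ⊆ Set.Iic d)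
    {x : EuclideanSpace ℝ (Fin d)} {m : Fin d} (hm : x m ≠ 0)
    (hxm : x ∈ initialFlat d (m + 1)) :
    x ∈ stairs d T ↔ (m : ℕ) + 1 ∈ T ∧ 1 ≤ x m := by
  constructor
  · rintro ⟨n, hnT, hx, hn⟩
    rcases n with _ | n
    · exact absurd (hx m (Nat.zero_le _)) hm
    · have h1 := hn ⟨n, hT hnT⟩ rfl
      obtain rfl := last_ne_zero_unique hm hxm (n := ⟨n, hT hnT⟩) (by linarith) hx
      exact ⟨hnT, h1⟩
  · rintro ⟨h, h1⟩
    refine ⟨m + 1, h, hxm, fun i hi => ?_⟩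
    obtain rfl : i = m := Fin.ext (by omega)
    exact h1

theorem mem_upperPart_iff_of_last_ne_zero {d : ℕ} {T : Set ℕ}
    {x : EuclideanSpace ℝ (Fin d)} {m : Fin d} (hm : x m ≠ 0)
    (hxm : x ∈ initialFlat d (m + 1)) :
    x ∈ upperPart d T ↔ 0 < x m ∧ ((m : ℕ) + 1 ∈ T → x m < 1) := by
  constructor
  · rintro (⟨rfl, -⟩ | ⟨n, hn, hnT, hx⟩)
    · simp at hm
    · obtain rfl := last_ne_zero_unique hm hxm hn.ne' hx
      exact ⟨hn, hnT⟩
  · exact fun ⟨h, h1⟩ => Or.inr ⟨m, h, h1, hxm⟩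

theorem mem_lowerPart_iff_of_last_ne_zero {d : ℕ}
    {x : EuclideanSpace ℝ (Fin d)} {m : Fin d} (hm : x m ≠ 0)
    (hxm : x ∈ initialFlat d (m + 1)) :
    x ∈ lowerPart d ↔ x m < 0 := by
  constructor
  · rintro ⟨n, hn, hx⟩
    obtain rfl := last_ne_zero_unique hm hxm hn.ne hx
    exact hn
  · exact fun h => ⟨m, h, hxm⟩

theorem compl_lowerPart_union_upperPart {d : ℕ} {T : Set ℕ} (hT : T ⊆ Set.Iic d) :
    (lowerPart d ∪ upperPart d T)ᶜ = stairs d T := by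
  ext x
  rcases eq_zero_or_exists_last_ne_zero x with rfl | ⟨m, hm, hxm⟩
  · rw [zero_mem_stairs hT]
    simp [lowerPart, upperPart]
  · rw [mem_stairs_iff_of_last_ne_zero hT hm hxm, Set.mem_compl_iff, Set.mem_union,
      mem_upperPart_iff_of_last_ne_zero hm hxm, mem_lowerPart_iff_of_last_ne_zero hm hxm]
    have : x m < 0 ∨ 0 < x m := lt_or_gt_of_ne hm
    by_cases h : (m : ℕ) + 1 ∈ T <;> simp only [h, true_and, false_and, true_imp_iff, false_imp_iff]
    · constructor
      · intro h'
        push Not at h'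
        rcases this with h0 | h0
        · linarith [h'.1]
        · exact h'.2 h0
      · rintro h1 (h0 | h0)
        · linarith
        · linarith [h0.2]
    · tauto

theorem abs_sub_apply_lt_of_mem_ball {d : ℕ} {p x : EuclideanSpace ℝ (Fin d)} {r : ℝ}
    (hx : x ∈ ball p r) (i : Fin d) : |x i - p i| < r := by
  rw [mem_ball, dist_eq_norm] at hx
  simpa using (PiLp.norm_apply_le (x - p) i).trans_lt hx

/-- Within distance `1` of a point of one half-flat, no other half-flat is met. -/
theorem stairs_inter_ball {d n : ℕ} {T : Set ℕ} (hT : T ⊆ Set.Iic d) (hn : n ∈ T)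
    {p : EuclideanSpace ℝ (Fin d)} (hp : p ∈ halfFlat d n) :
    stairs d T ∩ ball p 1 = halfFlat d n ∩ ball p 1 := by
  refine Set.Subset.antisymm ?_ fun x hx => ⟨⟨n, hn, hx.1⟩, hx.2⟩
  rintro x ⟨⟨m, hm, hx⟩, hxp⟩
  refine ⟨?_, hxp⟩
  rcases lt_trichotomy m n with h | rfl | h
  · obtain ⟨n, rfl⟩ : ∃ n', n = n' + 1 := ⟨n - 1, by omega⟩
    have h1 := hp.2 ⟨n, hT hn⟩ rfl
    have h2 := hx.1 ⟨n, hT hn⟩ (by simpa using Nat.lt_succ_iff.mp h)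
    have h3 := abs_lt.mp (abs_sub_apply_lt_of_mem_ball hxp ⟨n, hT hn⟩)
    linarith [h3.1]
  · exact hx
  · obtain ⟨m, rfl⟩ : ∃ m', m = m' + 1 := ⟨m - 1, by omega⟩
    have h1 := hx.2 ⟨m, hT hm⟩ rfl
    have h2 := hp.1 ⟨m, hT hm⟩ (by simpa using Nat.lt_succ_iff.mp h)
    have h3 := abs_lt.mp (abs_sub_apply_lt_of_mem_ball hxp ⟨m, hT hm⟩)
    linarith [h3.2]

theorem exists_pos_add_smul_mem {E : Type*} [NormedAddCommGroup E] [NormedSpace ℝ E] {V : Set E}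
    (hV : IsOpen V) {p : E} (hp : p ∈ V) (v : E) : ∃ t : ℝ, 0 < t ∧ p + t • v ∈ V := by
  have hc : Filter.Tendsto (fun t : ℝ => p + t • v) (nhds 0) (nhds p) := by
    have : Continuous fun t : ℝ => p + t • v := by fun_prop
    simpa using this.tendsto 0
  have h1 := (hc.eventually (hV.mem_nhds hp)).filter_mono (nhdsWithin_le_nhds (s := Set.Ioi 0))
  obtain ⟨t, ht, ht0⟩ := (h1.and self_mem_nhdsWithin).exists
  exact ⟨t, ht0, ht⟩

theorem direction_eq_of_halfFlat_inter_eq {d n : ℕ} {p : EuclideanSpace ℝ (Fin d)}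
    (hp : p ∈ halfFlat d n) {H : AffineSubspace ℝ (EuclideanSpace ℝ (Fin d))}
    {V : Set (EuclideanSpace ℝ (Fin d))} (hV : IsOpen V) (hpV : p ∈ V)
    (h : halfFlat d n ∩ V = (H : Set (EuclideanSpace ℝ (Fin d))) ∩ V) :
    H.direction = initialFlat d n := by
  have hpH : p ∈ H := (h.subset ⟨hp, hpV⟩).1
  refine le_antisymm (fun v hv => ?_) ?_
  · obtain ⟨t, ht, htV⟩ := exists_pos_add_smul_mem hV hpV v
    have hmem : p + t • v ∈ H := by
      simpa [add_comm] using
        AffineSubspace.vadd_mem_of_mem_direction (H.direction.smul_mem t hv) hpH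
    have h1 : p + t • v ∈ initialFlat d n := (h.superset ⟨hmem, htV⟩).1.1
    have h2 := (Submodule.add_mem_iff_right _ hp.1).mp h1
    exact (Submodule.smul_mem_iff _ ht.ne').mp h2
  · have key : ∀ v ∈ initialFlat d n, (∀ i : Fin d, (i : ℕ) + 1 = n → 0 ≤ v i) →
        v ∈ H.direction := by
      intro v hv hv0
      obtain ⟨t, ht, htV⟩ := exists_pos_add_smul_mem hV hpV v
      have hmem : p + t • v ∈ halfFlat d n := by
        refine ⟨Submodule.add_mem _ hp.1 (Submodule.smul_mem _ _ hv), fun i hi => ?_⟩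
        have := mul_nonneg ht.le (hv0 i hi)
        simpa using by linarith [hp.2 i hi]
      have h1 := AffineSubspace.vsub_mem_direction (h.subset ⟨hmem, htV⟩).1 hpH
      simpa [ht.ne'] using (Submodule.smul_mem_iff _ (inv_ne_zero ht.ne')).mpr h1
    intro v hv
    by_cases hv0 : ∀ i : Fin d, (i : ℕ) + 1 = n → 0 ≤ v i
    · exact key v hv hv0
    · push Not at hv0
      obtain ⟨i, hi, hvi⟩ := hv0
      refine (Submodule.neg_mem_iff _).mp (key (-v) (Submodule.neg_mem _ hv) fun j hj => ?_)
      obtain rfl : j = i := Fin.ext (by omega)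
      simpa using hvi.le

theorem HasSimplex.mono {d k : ℕ} {S S' : Set (EuclideanSpace ℝ (Fin d))} (h : HasSimplex S k)
    (hS : S ⊆ S') : HasSimplex S' k := by
  obtain ⟨f, hf, hfS⟩ := h
  exact ⟨f, hf, hfS.trans hS⟩

theorem HasSimplex.le_finrank {d k : ℕ} {W : Submodule ℝ (EuclideanSpace ℝ (Fin d))}
    (h : HasSimplex (W : Set (EuclideanSpace ℝ (Fin d))) k) : k ≤ finrank ℝ W := by
  obtain ⟨f, hf, hfS⟩ := h
  rw [← hf.finrank_vectorSpan (n := k) (by simp)]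
  refine Submodule.finrank_mono ?_
  rw [vectorSpan_def, Submodule.span_le]
  rintro _ ⟨x, hx, y, hy, rfl⟩
  exact W.sub_mem (hfS (subset_convexHull ℝ _ hx)) (hfS (subset_convexHull ℝ _ hy))

theorem bddAbove_hasSimplex {d : ℕ} (S : Set (EuclideanSpace ℝ (Fin d))) :
    BddAbove {k | HasSimplex S k} :=
  ⟨_, fun _ hk => HasSimplex.le_finrank (W := ⊤) (hk.mono (Set.subset_univ S))⟩

theorem hasSimplex_submodule_inter_ball {d : ℕ} (W : Submodule ℝ (EuclideanSpace ℝ (Fin d)))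
    {p : EuclideanSpace ℝ (Fin d)} (hp : p ∈ W) {r : ℝ} (hr : 0 < r) :
    HasSimplex ((W : Set (EuclideanSpace ℝ (Fin d))) ∩ ball p r) (finrank ℝ W) := by
  let b := stdOrthonormalBasis ℝ W
  let f : Fin (finrank ℝ W + 1) → EuclideanSpace ℝ (Fin d) :=
    Fin.cons p fun i => p + (r / 2) • (b i : EuclideanSpace ℝ (Fin d))
  refine ⟨f, ?_, convexHull_min ?_ (W.convex.inter (convex_ball p r))⟩
  · rw [affineIndependent_iff_linearIndependent_vsub ℝ _ 0,
      ← linearIndependent_equiv (finSuccAboveEquiv 0)]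
    have hb : LinearIndependent ℝ fun i => (b i : EuclideanSpace ℝ (Fin d)) :=
      b.orthonormal.linearIndependent.map' W.subtype W.ker_subtype
    have hf : (fun i : {x // x ≠ (0 : Fin (finrank ℝ W + 1))} => f i -ᵥ f 0) ∘
        finSuccAboveEquiv 0 = fun i => (r / 2) • (b i : EuclideanSpace ℝ (Fin d)) := by
      ext i : 1
      simp [f, finSuccAboveEquiv_apply]
    rw [hf]
    exact hb.units_smul fun _ => Units.mk0 (r / 2) (half_pos hr).ne'
  · rintro _ ⟨i, rfl⟩
    induction i using Fin.cases with
    | zero => exact ⟨hp, mem_ball_self hr⟩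
    | succ i =>
      refine ⟨W.add_mem hp (W.smul_mem _ (b i).2), ?_⟩
      have hbi : ‖(b i : EuclideanSpace ℝ (Fin d))‖ = 1 := b.orthonormal.1 i
      simp only [f, Fin.cons_succ, mem_ball, dist_self_add_left, norm_smul, hbi, mul_one,
        Real.norm_eq_abs, abs_of_pos (half_pos hr)]
      exact half_lt_self hr

theorem dm_eq_finrank {d : ℕ} (W : Submodule ℝ (EuclideanSpace ℝ (Fin d)))
    {p : EuclideanSpace ℝ (Fin d)} (hp : p ∈ W) {r : ℝ} (hr : 0 < r) :
    dm ((W : Set (EuclideanSpace ℝ (Fin d))) ∩ ball p r) = finrank ℝ W :=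
  le_antisymm
    (csSup_le ⟨_, hasSimplex_submodule_inter_ball W hp hr⟩
      fun _ hk => (hk.mono Set.inter_subset_left).le_finrank)
    (le_csSup (bddAbove_hasSimplex _) (hasSimplex_submodule_inter_ball W hp hr))

theorem dmLoc_eq_finrank {d : ℕ} {S : Set (EuclideanSpace ℝ (Fin d))}
    {W : Submodule ℝ (EuclideanSpace ℝ (Fin d))} {p : EuclideanSpace ℝ (Fin d)} (hp : p ∈ W)
    {r : ℝ} (hr : 0 < r)
    (h : S ∩ ball p r = (W : Set (EuclideanSpace ℝ (Fin d))) ∩ ball p r) :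
    dmLoc S p = finrank ℝ W := by
  have hmem : finrank ℝ W ∈ {m : ℕ | ∃ ε > 0, m = dm (S ∩ ball p ε)} :=
    ⟨r, hr, by rw [h, dm_eq_finrank W hp hr]⟩
  refine le_antisymm (Nat.sInf_le hmem) (le_csInf ⟨_, hmem⟩ ?_)
  rintro _ ⟨ε, hε, rfl⟩
  refine le_csSup (bddAbove_hasSimplex _)
    ((hasSimplex_submodule_inter_ball W hp (lt_min hr hε)).mono ?_)
  rintro x ⟨hxW, hx⟩
  exact ⟨(h.superset ⟨hxW, ball_subset_ball (min_le_left _ _) hx⟩).1,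
    ball_subset_ball (min_le_right _ _) hx⟩

theorem exists_isOrdinaryFlat_stairs {d k : ℕ} {T : Set ℕ} (hT : T ⊆ Set.Iic d) (hk : k ∈ T) :
    ∃ H, IsOrdinaryFlat (stairs d T) k H := by
  let p : EuclideanSpace ℝ (Fin d) := WithLp.toLp 2 fun j => if (j : ℕ) + 1 = k then 2 else 0
  have hpF : p ∈ initialFlat d k := by
    intro j hj
    have : (j : ℕ) + 1 ≠ k := by omega
    simp [p, this]
  have hp : p ∈ halfFlat d k := ⟨hpF, fun i hi => by simp [p, hi]⟩
  have hS : stairs d T ∩ ball p 1 = (initialFlat d k : Set _) ∩ ball p 1 := by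
    rw [stairs_inter_ball hT hk hp]
    refine Set.Subset.antisymm (fun x hx => ⟨hx.1.1, hx.2⟩) fun x hx =>
      ⟨⟨hx.1, fun i hi => ?_⟩, hx.2⟩
    have h1 := (abs_lt.mp (abs_sub_apply_lt_of_mem_ball hx.2 i)).1
    have h2 : p i = 2 := by simp [p, hi]
    linarith
  have hrank := finrank_initialFlat (hT hk)
  refine ⟨(initialFlat d k).toAffineSubspace, by rwa [Submodule.toAffineSubspace_direction], p, ⟨k, hk, hp⟩, ?_,
    ball p 1, isOpen_ball, mem_ball_self one_pos, hS⟩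
  rw [dmLoc_eq_finrank hpF one_pos hS, hrank]

theorem mem_of_isOrdinaryFlat_stairs {d k : ℕ} {T : Set ℕ} (hT : T ⊆ Set.Iic d)
    {H : AffineSubspace ℝ (EuclideanSpace ℝ (Fin d))} (h : IsOrdinaryFlat (stairs d T) k H) :
    k ∈ T := by
  obtain ⟨rfl, p, ⟨n, hn, hp⟩, -, U, hU, hpU, hSU⟩ := h
  have hV : halfFlat d n ∩ (ball p 1 ∩ U) =
      (H : Set (EuclideanSpace ℝ (Fin d))) ∩ (ball p 1 ∩ U) := by
    rw [← Set.inter_assoc, ← stairs_inter_ball hT hn hp, Set.inter_right_comm, hSU,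
      Set.inter_right_comm, Set.inter_assoc]
  rw [direction_eq_of_halfFlat_inter_eq hp (isOpen_ball.inter hU)
    ⟨mem_ball_self one_pos, hpU⟩ hV, finrank_initialFlat (hT hn)]
  exact hn


/-- For every `d ≥ 1` and every `T ⊆ {0, …, d}` there are two convex sets
`K₁, K₂ ⊆ ℝ^d` such that `S = ℝ^d \ (K₁ ∪ K₂)` has a `k`-ordinary flat
exactly for `k ∈ T`. -/
theorem exists_two_convex_with_prescribed_ordinary_dims (d : ℕ) (hd : 1 ≤ d)
    (T : Set ℕ) (hT : T ⊆ Set.Iic d) :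
    ∃ K₁ K₂ : Set (EuclideanSpace ℝ (Fin d)),
      Convex ℝ K₁ ∧ Convex ℝ K₂ ∧
      ∀ k ≤ d,
        ((∃ H : AffineSubspace ℝ (EuclideanSpace ℝ (Fin d)),
          IsOrdinaryFlat (K₁ ∪ K₂)ᶜ k H) ↔ k ∈ T) := by
  refine ⟨lowerPart d, upperPart d T, convex_lowerPart d, convex_upperPart d T, fun k _ => ?_⟩
  rw [compl_lowerPart_union_upperPart hT]
  exact ⟨fun ⟨_, h⟩ => mem_of_isOrdinaryFlat_stairs hT h, exists_isOrdinaryFlat_stairs hT⟩
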